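/- The whole sequence {(x^k, w^k)} generated by Algorithm iPALM converges to a point (x^∞, w^∞) that solves the KKT system of (P). -/

import Mathlib

open scoped RealInnerProductSpace
open Filter Topology ContinuousLinearMap

/-- The set of subgradients (in the sense of convex analysis) of an
extended-real-valued function on a real inner product space. -/
def ESubdiff {W : Type*} [NormedAddCommGroup W] [InnerProductSpace ℝ W]
    (φ : W → EReal) (w : W) : Set W :=
  {d | ∀ u : W, φ w + ((⟪d, u - w⟫ : ℝ) : EReal) ≤ φ u}

/-- Convexity of an extended-real-valued function. -/
def EConvex {W : Type*} [AddCommGroup W] [Module ℝ W] (φ : W → EReal) : Prop :=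
  ∀ u v : W, ∀ a b : ℝ, 0 ≤ a → 0 ≤ b → a + b = 1 →
    φ (a • u + b • v) ≤ (a : EReal) * φ u + (b : EReal) * φ v

/-- Subgradients can only exist in the effective domain. -/
theorem ne_top_of_mem_ESubdiff {W : Type*} [NormedAddCommGroup W] [InnerProductSpace ℝ W]
    {φ : W → EReal} {w d u : W} (hd : d ∈ ESubdiff φ w) (hu : φ u ≠ ⊤) : φ w ≠ ⊤ := by
  intro hw
  have h1 := hd u
  rw [hw, EReal.top_add_coe, top_le_iff] at h1
  exact hu h1

theorem ESubdiff_monotone {W : Type*} [NormedAddCommGroup W] [InnerProductSpace ℝ W]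
    {φ : W → EReal} (hbot : ∀ v, φ v ≠ ⊥) (htop : ∃ v, φ v ≠ ⊤) {u v a b : W}
    (ha : a ∈ ESubdiff φ u) (hb : b ∈ ESubdiff φ v) : 0 ≤ ⟪a - b, u - v⟫ := by
  obtain ⟨v₀, hv₀⟩ := htop
  have h1 := ha v
  have h2 := hb u
  lift φ u to ℝ using ⟨ne_top_of_mem_ESubdiff ha hv₀, hbot u⟩ with p
  lift φ v to ℝ using ⟨ne_top_of_mem_ESubdiff hb hv₀, hbot v⟩ with q
  norm_cast at h1 h2
  have h3 : ⟪a, v - u⟫ = -⟪a, u - v⟫ := by rw [← inner_neg_right, neg_sub]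
  rw [inner_sub_left]
  linarith

theorem nonpos_of_forall_le_mul {b C : ℝ} (hb : ∀ t : ℝ, 0 < t → t ≤ 1 → b ≤ t * C) : b ≤ 0 := by
  have h1 : Tendsto (fun t : ℝ => t * C) (𝓝[>] 0) (𝓝 0) := by
    have : Tendsto (fun t : ℝ => t * C) (𝓝 0) (𝓝 (0 * C)) := tendsto_id.mul_const C
    rw [zero_mul] at this
    exact this.mono_left nhdsWithin_le_nhds
  refine ge_of_tendsto h1 ?_
  filter_upwards [Ioc_mem_nhdsGT (zero_lt_one' ℝ)] with t ht
  exact hb t ht.1 ht.2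

/-- A summand that has a quadratic upper model at `w` can be removed from a subdifferential
inclusion by subtracting its gradient. -/
theorem sub_mem_ESubdiff_of_add {W : Type*} [NormedAddCommGroup W] [InnerProductSpace ℝ W]
    {φ : W → EReal} (hconv : EConvex φ) (hbot : ∀ v, φ v ≠ ⊥) {q : W → ℝ} {w g d : W}
    (Q : W → ℝ) (hq : ∀ (t : ℝ) (v : W), q (w + t • v) = q w + t * ⟪g, v⟫ + t ^ 2 * Q v)
    (hd : d ∈ ESubdiff (fun v => φ v + (q v : EReal)) w) : d - g ∈ ESubdiff φ w := by
  intro u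
  by_cases hu : φ u = ⊤
  · rw [hu]; exact le_top
  have hw : φ w ≠ ⊤ := by
    intro h2
    refine ne_top_of_mem_ESubdiff (φ := fun v => φ v + (q v : EReal)) hd (u := u)
      (EReal.add_ne_top hu (EReal.coe_ne_top _)) ?_
    simp only [h2, EReal.top_add_coe]
  obtain ⟨p, hp⟩ : ∃ p : ℝ, φ u = p := ⟨_, (EReal.coe_toReal hu (hbot u)).symm⟩
  obtain ⟨b, hb⟩ : ∃ b : ℝ, φ w = b := ⟨_, (EReal.coe_toReal hw (hbot w)).symm⟩
  have key : b + ⟪d - g, u - w⟫ - p ≤ 0 := by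
    refine nonpos_of_forall_le_mul (C := Q (u - w)) fun t ht0 ht1 => ?_
    have h1 := hd (w + t • (u - w))
    have h2 := hconv w u (1 - t) t (by linarith) ht0.le (by ring)
    have h3 : (1 - t) • w + t • u = w + t • (u - w) := by module
    rw [h3, hb, hp] at h2
    simp only [hb, hq, add_sub_cancel_left, inner_smul_right] at h1
    have h4 : φ (w + t • (u - w)) ≠ ⊤ := by
      intro h5
      rw [h5] at h2
      norm_cast at h2
    obtain ⟨r, hr⟩ : ∃ r : ℝ, φ (w + t • (u - w)) = r :=
      ⟨_, (EReal.coe_toReal h4 (hbot _)).symm⟩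
    rw [hr] at h1 h2
    norm_cast at h1 h2
    rw [inner_sub_left]
    refine le_of_mul_le_mul_left ?_ ht0
    linarith
  rw [hp, hb]
  norm_cast
  linarith

/-- The graph of the subdifferential of a lower semicontinuous function is closed. -/
theorem mem_ESubdiff_of_tendsto {W : Type*} [NormedAddCommGroup W] [InnerProductSpace ℝ W]
    {φ : W → EReal} (hlsc : LowerSemicontinuous φ) (hbot : ∀ v, φ v ≠ ⊥) {g u : ℕ → W} {g₀ u₀ : W}
    (hg : Tendsto g atTop (𝓝 g₀)) (hu : Tendsto u atTop (𝓝 u₀))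
    (hmem : ∀ n, g n ∈ ESubdiff φ (u n)) : g₀ ∈ ESubdiff φ u₀ := by
  intro v
  by_cases hv : φ v = ⊤
  · rw [hv]; exact le_top
  obtain ⟨p, hp⟩ : ∃ p : ℝ, φ v = p := ⟨_, (EReal.coe_toReal hv (hbot v)).symm⟩
  have h1 : ∀ n, φ (u n) ≤ ((p - ⟪g n, v - u n⟫ : ℝ) : EReal) := by
    intro n
    have h2 := hmem n v
    lift φ (u n) to ℝ using ⟨ne_top_of_mem_ESubdiff (hmem n) hv, hbot _⟩ with r
    rw [hp] at h2
    norm_cast at h2 ⊢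
    linarith
  have h3 : Tendsto (fun n => ((p - ⟪g n, v - u n⟫ : ℝ) : EReal)) atTop
      (𝓝 ((p - ⟪g₀, v - u₀⟫ : ℝ) : EReal)) :=
    (continuous_coe_real_ereal.tendsto _).comp
      ((hg.inner (tendsto_const_nhds.sub hu)).const_sub p)
  have h4 : φ u₀ ≤ ((p - ⟪g₀, v - u₀⟫ : ℝ) : EReal) := by
    refine le_of_forall_lt fun y hy => ?_
    obtain ⟨z, hyz, hz⟩ := exists_between hy
    have h5 : ∀ᶠ n in atTop, z < φ (u n) := hu.eventually (hlsc u₀ z hz)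
    exact hyz.trans_le (ge_of_tendsto h3 (h5.mono fun n hn => hn.le.trans (h1 n)))
  have h6 : φ u₀ ≠ ⊤ := fun h7 => by
    rw [h7, top_le_iff] at h4
    exact EReal.coe_ne_top _ h4
  rw [hp]
  lift φ u₀ to ℝ using ⟨h6, hbot _⟩ with r
  norm_cast at h4 ⊢
  linarith

theorem ConvexOn.add_inner_gradient_le {W : Type*} [NormedAddCommGroup W] [InnerProductSpace ℝ W]
    [CompleteSpace W] {h : W → ℝ} (hconv : ConvexOn ℝ Set.univ h) (hdiff : Differentiable ℝ h)
    (u v : W) : h v + ⟪gradient h v, u - v⟫ ≤ h u := by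
  have hline : HasDerivAt (fun t : ℝ => v + t • (u - v)) (u - v) 0 := by
    simpa using ((hasDerivAt_id (0 : ℝ)).smul_const (u - v)).const_add v
  have hgrad : HasFDerivAt h (fderiv ℝ h v) (v + (0 : ℝ) • (u - v)) := by
    simpa using (hdiff v).hasFDerivAt
  have hder : HasDerivAt (fun t : ℝ => h (v + t • (u - v))) ⟪gradient h v, u - v⟫ 0 := by
    rw [inner_gradient_left]
    exact hgrad.comp_hasDerivAt (0 : ℝ) hline
  have hslope := hder.tendsto_slope_zero_right
  have hbound : ⟪gradient h v, u - v⟫ ≤ h u - h v := by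
    refine le_of_tendsto hslope ?_
    filter_upwards [Ioc_mem_nhdsGT (zero_lt_one' ℝ)] with t ht
    have h1 := hconv.2 (Set.mem_univ v) (Set.mem_univ u) (sub_nonneg.2 ht.2) ht.1.le (by ring)
    have h2 : (1 - t) • v + t • u = v + t • (u - v) := by module
    rw [h2] at h1
    simp only [smul_eq_mul, zero_add, zero_smul, add_zero] at h1 ⊢
    rw [inv_mul_le_iff₀ ht.1]
    linarith
  linarith

/-- A quadratically majorized convex function satisfies a shifted cocoercivity inequality. -/
theorem inner_gradient_sub_ge {W : Type*} [NormedAddCommGroup W] [InnerProductSpace ℝ W]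
    [CompleteSpace W] {h : W → ℝ} (hconv : ConvexOn ℝ Set.univ h) (hdiff : Differentiable ℝ h)
    (Sig : W →L[ℝ] W)
    (hmaj : ∀ u v : W, h u ≤ h v + ⟪gradient h v, u - v⟫ + (1 / 2) * ⟪Sig (u - v), u - v⟫)
    (u v z : W) :
    -(1 / 4) * ⟪Sig (z - u), z - u⟫ ≤ ⟪gradient h u - gradient h v, z - v⟫ := by
  obtain ⟨t, ht⟩ : ∃ t : W, u - z = (2 : ℝ) • t := ⟨(1 / 2 : ℝ) • (u - z), by module⟩
  have hz : z = u - (2 : ℝ) • t := by rw [← ht]; abel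
  have h1 := hmaj (v + t) v
  have h2 := hmaj (u - t) u
  have h3 := hconv.add_inner_gradient_le hdiff (v + t) u
  have h4 := hconv.add_inner_gradient_le hdiff (u - t) v
  have e1 : v + t - v = t := by abel
  have e2 : u - t - u = -t := by abel
  have e3 : u - (2 : ℝ) • t - u = -((2 : ℝ) • t) := by abel
  rw [e1] at h1
  rw [e2] at h2
  rw [hz, e3]
  simp only [map_neg, map_smul, inner_neg_left, inner_neg_right, inner_smul_left, inner_smul_right,
    inner_sub_left, inner_sub_right, inner_add_right, RCLike.conj_to_real] at *
  linarith

theorem exists_pos_mul_norm_sq_le {W : Type*} [NormedAddCommGroup W] [InnerProductSpace ℝ W]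
    [FiniteDimensional ℝ W] {q : W → ℝ} (hcont : Continuous q)
    (hhom : ∀ (t : ℝ) (v : W), q (t • v) = t ^ 2 * q v) (hpos : ∀ v, v ≠ 0 → 0 < q v) :
    ∃ μ : ℝ, 0 < μ ∧ ∀ v, μ * ‖v‖ ^ 2 ≤ q v := by
  have hq0 : q 0 = 0 := by simpa using hhom 0 0
  rcases (Metric.sphere (0 : W) 1).eq_empty_or_nonempty with hempty | hne
  · refine ⟨1, one_pos, fun v => ?_⟩
    by_cases hv : v = 0
    · simp [hv, hq0]
    · have : ‖v‖⁻¹ • v ∈ Metric.sphere (0 : W) 1 := by simp [norm_smul, hv]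
      simp [hempty] at this
  · obtain ⟨v₀, hv₀, hmin⟩ := (isCompact_sphere (0 : W) 1).exists_isMinOn hne hcont.continuousOn
    refine ⟨q v₀, hpos v₀ (ne_zero_of_mem_unit_sphere ⟨v₀, hv₀⟩), fun v => ?_⟩
    by_cases hv : v = 0
    · simp [hv, hq0]
    · have hmem : ‖v‖⁻¹ • v ∈ Metric.sphere (0 : W) 1 := by simp [norm_smul, hv]
      have h1 : q v₀ ≤ q (‖v‖⁻¹ • v) := hmin hmem
      rw [hhom] at h1
      have hn : 0 < ‖v‖ := norm_pos_iff.2 hv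
      calc q v₀ * ‖v‖ ^ 2 ≤ (‖v‖⁻¹ ^ 2 * q v) * ‖v‖ ^ 2 := by gcongr
        _ = q v := by field_simp

/-- A nonnegative sequence that decreases up to summable errors converges, and the
decrements are summable. -/
theorem quasi_descent {V p δ : ℕ → ℝ} (hV : ∀ k, 0 ≤ V k) (hp : ∀ k, 0 ≤ p k)
    (hδ : ∀ k, 0 ≤ δ k) (hsum : Summable δ) (hstep : ∀ k, V (k + 1) + p k ≤ V k + δ k) :
    (∃ l, Tendsto V atTop (𝓝 l)) ∧ Summable p := by
  have hle : ∀ n, ∑ i ∈ Finset.range n, δ i ≤ ∑' i, δ i := fun n =>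
    hsum.sum_le_tsum _ fun i _ => hδ i
  constructor
  · have hanti : Antitone fun n => V n - ∑ i ∈ Finset.range n, δ i := by
      refine antitone_nat_of_succ_le fun n => ?_
      rw [Finset.sum_range_succ]
      linarith [hstep n, hp n]
    have hbdd : BddBelow (Set.range fun n => V n - ∑ i ∈ Finset.range n, δ i) := by
      refine ⟨-∑' i, δ i, ?_⟩
      rintro _ ⟨n, rfl⟩
      linarith [hV n, hle n]
    have h1 := (tendsto_atTop_ciInf hanti hbdd).add hsum.hasSum.tendsto_sum_nat
    exact ⟨_, by simpa using h1⟩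
  · refine summable_of_sum_range_le (c := V 0 + ∑' i, δ i) hp fun n => ?_
    have h1 : ∑ i ∈ Finset.range n, p i ≤ V 0 - V n + ∑ i ∈ Finset.range n, δ i := by
      induction n with
      | zero => simp
      | succ n ih =>
        rw [Finset.sum_range_succ, Finset.sum_range_succ]
        linarith [hstep n]
    linarith [hV n, hle n]

theorem bounded_of_sq_step {s δ : ℕ → ℝ} (hs : ∀ k, 0 ≤ s k) (hδ : ∀ k, 0 ≤ δ k)
    (hsum : Summable δ) (hstep : ∀ k, s (k + 1) ^ 2 ≤ s k ^ 2 + δ k * s (k + 1)) :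
    ∃ M, ∀ k, s k ≤ M := by
  have h1 : ∀ k, s (k + 1) ≤ s k + δ k := by
    intro k
    by_contra! hlt
    nlinarith [hstep k, hs k, hs (k + 1), hδ k]
  obtain ⟨⟨l, hl⟩, -⟩ := quasi_descent (p := 0) hs (fun _ => le_rfl) hδ hsum (by simpa using h1)
  obtain ⟨M, hM⟩ := hl.bddAbove_range
  exact ⟨M, fun k => hM ⟨k, rfl⟩⟩

/-- The model function minimized in one iteration splits off its gradient: the subproblem's
optimality condition becomes a subgradient inclusion for `φ` alone. -/
theorem iPALM_subgradient {X W : Type*} [NormedAddCommGroup X] [InnerProductSpace ℝ X]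
    [CompleteSpace X] [NormedAddCommGroup W] [InnerProductSpace ℝ W] [CompleteSpace W]
    {φ : W → EReal} (hconv : EConvex φ) (hbot : ∀ v, φ v ≠ ⊥) (A : X →L[ℝ] W) (c x : X)
    (σ a : ℝ) {Sig : W →L[ℝ] W} (hSig : IsSelfAdjoint Sig) {g w w' d : W}
    (hd : d ∈ ESubdiff (fun v : W =>
        φ v + ((a + ⟪g, v - w⟫ + (1 / 2) * ⟪Sig (v - w), v - w⟫ + ⟪A.adjoint v - c, x⟫
          + (σ / 2) * ‖A.adjoint v - c‖ ^ 2 : ℝ) : EReal)) w') :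
    d - (g + Sig (w' - w) + A (x + σ • (A.adjoint w' - c))) ∈ ESubdiff φ w' := by
  refine sub_mem_ESubdiff_of_add hconv hbot
    (fun v => (1 / 2) * ⟪Sig v, v⟫ + (σ / 2) * ‖A.adjoint v‖ ^ 2) (fun t v => ?_) hd
  have h1 : w' + t • v - w = (w' - w) + t • v := by abel
  have h2 : A.adjoint (w' + t • v) - c = (A.adjoint w' - c) + t • A.adjoint v := by
    rw [map_add, map_smul]; abel
  have h3 : ⟪Sig v, w' - w⟫ = ⟪Sig (w' - w), v⟫ := by
    rw [hSig.isSymmetric.apply_clm v (w' - w), real_inner_comm]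
  have hA : ∀ y, ⟪A y, v⟫ = ⟪A.adjoint v, y⟫ := fun y => by
    rw [← A.adjoint_inner_right, real_inner_comm]
  rw [h1, h2, norm_add_sq_real, norm_smul, mul_pow, Real.norm_eq_abs, sq_abs, map_add, map_smul]
  simp only [inner_add_left, inner_add_right, inner_smul_left, inner_smul_right,
    RCLike.conj_to_real, h3, hA, map_add, map_smul,
    real_inner_comm (A.adjoint w' - c) (A.adjoint v)]
  ring

/-- One-step estimate for the Lyapunov function attached to a KKT point. -/
theorem iPALM_step {X W : Type*} [NormedAddCommGroup X] [InnerProductSpace ℝ X]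
    [CompleteSpace X] [NormedAddCommGroup W] [InnerProductSpace ℝ W] [CompleteSpace W]
    {φ : W → EReal} (hbot : ∀ v, φ v ≠ ⊥) (htop : ∃ v, φ v ≠ ⊤)
    {h : W → ℝ} (hconv : ConvexOn ℝ Set.univ h) (hdiff : Differentiable ℝ h)
    (A : X →L[ℝ] W) (c : X) {σ τ : ℝ} (hσ : 0 < σ) (hτ : 0 < τ) {Sig S : W →L[ℝ] W}
    (hSig : IsSelfAdjoint Sig) (hS : IsSelfAdjoint S)
    (hmaj : ∀ u v : W, h u ≤ h v + ⟪gradient h v, u - v⟫ + (1 / 2) * ⟪Sig (u - v), u - v⟫)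
    {x x' xs : X} {w w' ws d : W} (hs : -(gradient h ws) - A xs ∈ ESubdiff φ ws)
    (hfeas : A.adjoint ws = c)
    (hw : d - S (w' - w) - (gradient h w + Sig (w' - w) + A (x + σ • (A.adjoint w' - c)))
      ∈ ESubdiff φ w')
    (hx : x' = x + (τ * σ) • (A.adjoint w' - c)) :
    ⟪Sig (w' - ws), w' - ws⟫ + ⟪S (w' - ws), w' - ws⟫ + ‖x' - xs‖ ^ 2 / (τ * σ)
      + ((1 / 2) * ⟪Sig (w' - w), w' - w⟫ + ⟪S (w' - w), w' - w⟫
        + (2 - τ) * σ * ‖A.adjoint w' - c‖ ^ 2)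
      ≤ ⟪Sig (w - ws), w - ws⟫ + ⟪S (w - ws), w - ws⟫ + ‖x - xs‖ ^ 2 / (τ * σ)
        + 2 * (‖d‖ * ‖w' - ws‖) := by
  have h1 := ESubdiff_monotone hbot htop hw hs
  have h2 := inner_gradient_sub_ge hconv hdiff Sig hmaj w ws w'
  have h3 := real_inner_le_norm d (w' - ws)
  have hr : A.adjoint w' - c = A.adjoint (w' - ws) := by rw [map_sub, hfeas]
  obtain ⟨e, he⟩ : ∃ e, e = w' - ws := ⟨_, rfl⟩
  obtain ⟨D, hD⟩ : ∃ D, D = w' - w := ⟨_, rfl⟩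
  have hwe : w - ws = e - D := by rw [he, hD]; abel
  have hxs : x' - xs = (x - xs) + (τ * σ) • A.adjoint e := by rw [hx, hr, he]; abel
  have h4 : ‖x' - xs‖ ^ 2 / (τ * σ)
      = ‖x - xs‖ ^ 2 / (τ * σ) + 2 * ⟪x - xs, A.adjoint e⟫ + τ * σ * ‖A.adjoint e‖ ^ 2 := by
    rw [hxs, norm_add_sq_real, norm_smul, mul_pow, Real.norm_eq_abs, sq_abs, inner_smul_right]
    field_simp
  have hsigc : ⟪Sig e, D⟫ = ⟪Sig D, e⟫ := by
    rw [hSig.isSymmetric.apply_clm e D, real_inner_comm]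
  have hsc : ⟪S e, D⟫ = ⟪S D, e⟫ := by
    rw [hS.isSymmetric.apply_clm e D, real_inner_comm]
  have h5 : d - S D - (gradient h w + Sig D + A (x + σ • A.adjoint e)) - (-(gradient h ws) - A xs)
      = d - S D - Sig D - (gradient h w - gradient h ws) - A ((x - xs) + σ • A.adjoint e) := by
    simp only [map_add, map_sub]; abel
  rw [h4, hr, hwe]
  rw [hr] at h1
  rw [← he, ← hD] at h1 ⊢
  rw [← he, ← hD] at h2
  rw [← he] at h3
  rw [h5, inner_sub_left, inner_sub_left _ (gradient h w - gradient h ws), inner_sub_left,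
    inner_sub_left, ← A.adjoint_inner_right _ e, inner_add_left, inner_smul_left,
    RCLike.conj_to_real, real_inner_self_eq_norm_sq] at h1
  simp only [map_sub, inner_sub_left, inner_sub_right, hsigc, hsc] at h1 h2 ⊢
  linarith

/-- The whole sequence `{(x^k, w^k)}` generated by Algorithm iPALM
converges to a point `(x^∞, w^∞)` that solves the KKT system of (P). -/
theorem stmt_7
    {X W : Type*} [NormedAddCommGroup X] [InnerProductSpace ℝ X] [FiniteDimensional ℝ X]
    [NormedAddCommGroup W] [InnerProductSpace ℝ W] [FiniteDimensional ℝ W]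
    -- `φ` is a closed proper convex function on `W`
    (φ : W → EReal) (hφconv : EConvex φ) (hφlsc : LowerSemicontinuous φ)
    (hφbot : ∀ v, φ v ≠ ⊥) (hφtop : ∃ v, φ v ≠ ⊤)
    -- `h` is a convex continuously differentiable function on `W`
    (h : W → ℝ) (hhconv : ConvexOn ℝ Set.univ h) (hhdiff : ContDiff ℝ 1 h)
    -- problem data, penalty parameter and step-length
    (A : X →L[ℝ] W) (c : X) (σ τ : ℝ) (hσ : 0 < σ) (hτ0 : 0 < τ) (hτ2 : τ < 2)
    -- the majorization operator `Σ_h` (here `Sig`), self-adjoint positive semidefinite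
    (Sig S : W →L[ℝ] W) (hSigsa : IsSelfAdjoint Sig) (hSigpsd : ∀ v : W, 0 ≤ ⟪Sig v, v⟫)
    (hmaj : ∀ u v : W, h u ≤ h v + ⟪gradient h v, u - v⟫
      + (1 / 2) * ⟪Sig (u - v), u - v⟫)
    -- the proximal operator `S`: self-adjoint, `S ⪰ -(1/2)Σ_h`,
    -- and `(1/2)Σ_h + σAA* + S ≻ 0`
    (hSsa : IsSelfAdjoint S)
    (hS1 : ∀ v : W, -(1 / 2) * ⟪Sig v, v⟫ ≤ ⟪S v, v⟫)
    (hS2 : ∀ v : W, v ≠ 0 →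
      0 < (1 / 2) * ⟪Sig v, v⟫ + σ * ‖A.adjoint v‖ ^ 2 + ⟪S v, v⟫)
    -- the KKT system has a solution
    (hKKT : ∃ (xs : X) (ws : W),
      -(gradient h ws) - A xs ∈ ESubdiff φ ws ∧ A.adjoint ws = c)
    -- the iPALM iterates: errors, primal and dual sequences
    (ε : ℕ → ℝ) (hε : ∀ k, 0 ≤ ε k) (hεsum : Summable ε)
    (x : ℕ → X) (w : ℕ → W) (d : ℕ → W)
    (hd : ∀ k, ‖d k‖ ≤ ε k)
    -- `d^k ∈ ∂_w L_σ(w^{k+1}; (x^k, w^k)) + S(w^{k+1} - w^k)`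
    (hsub : ∀ k : ℕ, d k - S (w (k + 1) - w k) ∈
      ESubdiff (fun v : W =>
        φ v + ((h (w k) + ⟪gradient h (w k), v - w k⟫
          + (1 / 2) * ⟪Sig (v - w k), v - w k⟫
          + ⟪A.adjoint v - c, x k⟫
          + (σ / 2) * ‖A.adjoint v - c‖ ^ 2 : ℝ) : EReal)) (w (k + 1)))
    -- `x^{k+1} = x^k + τσ(A* w^{k+1} - c)`
    (hx : ∀ k : ℕ, x (k + 1) = x k + (τ * σ) • (A.adjoint (w (k + 1)) - c))
    :
    ∃ (xinf : X) (winf : W),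
      (-(gradient h winf) - A xinf ∈ ESubdiff φ winf ∧ A.adjoint winf = c) ∧
      Tendsto x atTop (nhds xinf) ∧ Tendsto w atTop (nhds winf) := by
  have hdiff : Differentiable ℝ h := hhdiff.differentiable one_ne_zero
  have hgradc : Continuous (gradient h) :=
    (InnerProductSpace.toDual ℝ W).symm.continuous.comp (hhdiff.continuous_fderiv one_ne_zero)
  have hτσ : 0 < τ * σ := mul_pos hτ0 hσ
  have hρ : 0 < (2 - τ) * σ := mul_pos (by linarith) hσ
  have hg : ∀ k, d k - S (w (k + 1) - w k) - (gradient h (w k) + Sig (w (k + 1) - w k)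
      + A (x k + σ • (A.adjoint (w (k + 1)) - c))) ∈ ESubdiff φ (w (k + 1)) := fun k =>
    iPALM_subgradient hφconv hφbot A c (x k) σ (h (w k)) hSigsa (hsub k)
  have hposT : ∀ v, 0 ≤ (1 / 2) * ⟪Sig v, v⟫ + ⟪S v, v⟫ := fun v => by linarith [hS1 v]
  have hposV : ∀ v, 0 ≤ ⟪Sig v, v⟫ + ⟪S v, v⟫ := fun v => by linarith [hS1 v, hSigpsd v]
  obtain ⟨μ, hμ, hcoer⟩ : ∃ μ : ℝ, 0 < μ ∧ ∀ v, μ * ‖v‖ ^ 2 ≤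
      (1 / 2) * ⟪Sig v, v⟫ + σ * ‖A.adjoint v‖ ^ 2 + ⟪S v, v⟫ := by
    refine exists_pos_mul_norm_sq_le (by fun_prop) (fun t v => ?_) hS2
    simp only [map_smul, inner_smul_left, inner_smul_right, norm_smul, mul_pow, Real.norm_eq_abs,
      sq_abs, RCLike.conj_to_real]
    ring
  set V : X → W → ℕ → ℝ := fun xs ws k =>
    ⟪Sig (w k - ws), w k - ws⟫ + ⟪S (w k - ws), w k - ws⟫ + ‖x k - xs‖ ^ 2 / (τ * σ) with hV
  set p : ℕ → ℝ := fun k => (1 / 2) * ⟪Sig (w (k + 1) - w k), w (k + 1) - w k⟫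
    + ⟪S (w (k + 1) - w k), w (k + 1) - w k⟫
    + (2 - τ) * σ * ‖A.adjoint (w (k + 1)) - c‖ ^ 2 with hp
  have hV0 : ∀ xs ws k, 0 ≤ V xs ws k := fun xs ws k => add_nonneg (hposV _) (by positivity)
  have hp0 : ∀ k, 0 ≤ p k := fun k => add_nonneg (hposT _) (by positivity)
  have hstep : ∀ xs ws, -(gradient h ws) - A xs ∈ ESubdiff φ ws → A.adjoint ws = c →
      ∀ k, V xs ws (k + 1) + p k ≤ V xs ws k + 2 * (ε k * ‖w (k + 1) - ws‖) := by
    intro xs ws hs hfeas k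
    refine (iPALM_step hφbot hφtop hhconv hdiff A c hσ hτ0 hSigsa hSsa hmaj hs hfeas (hg k)
      (hx k)).trans ?_
    gcongr
    exact hd k
  obtain ⟨xs, ws, hs, hfeas⟩ := hKKT
  -- boundedness of the iterates
  have hres : ∀ k, A.adjoint (w k) - c = A.adjoint (w k - ws) := fun k => by rw [map_sub, hfeas]
  obtain ⟨R, hR⟩ : ∃ R, ∀ k, ‖w k - ws‖ ≤ R := by
    obtain ⟨ρ, hρ0, hρle⟩ : ∃ ρ : ℝ, 0 < ρ ∧ ∀ k, ρ ^ 2 * ‖w k - ws‖ ^ 2 ≤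
        V xs ws k + (2 - τ) * σ * ‖A.adjoint (w k) - c‖ ^ 2 := by
      refine ⟨√(min 1 (2 - τ) * μ), Real.sqrt_pos.2 (by
        have := lt_min one_pos (sub_pos.2 hτ2); positivity), fun k => ?_⟩
      have hm : 0 < min 1 (2 - τ) := lt_min one_pos (sub_pos.2 hτ2)
      rw [Real.sq_sqrt (by positivity), hres]
      have h1 := mul_le_mul_of_nonneg_left (hcoer (w k - ws)) hm.le
      have h2 := mul_le_mul_of_nonneg_right (min_le_left 1 (2 - τ)) (hposT (w k - ws))
      have h3 := mul_le_mul_of_nonneg_right (min_le_right 1 (2 - τ))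
        (show 0 ≤ σ * ‖A.adjoint (w k - ws)‖ ^ 2 by positivity)
      have h4 : 0 ≤ ‖x k - xs‖ ^ 2 / (τ * σ) := by positivity
      have h5 := hSigpsd (w k - ws)
      simp only [hV]
      linarith
    set U : ℕ → ℝ := fun k => V xs ws k + (2 - τ) * σ * ‖A.adjoint (w k) - c‖ ^ 2 with hU
    have hU0 : ∀ k, 0 ≤ U k := fun k => add_nonneg (hV0 _ _ _) (by positivity)
    have hle : ∀ k, ‖w k - ws‖ ≤ ρ⁻¹ * √(U k) := by
      intro k
      rw [← div_eq_inv_mul, le_div_iff₀ hρ0]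
      refine Real.le_sqrt_of_sq_le ?_
      rw [mul_pow, mul_comm]
      exact hρle k
    obtain ⟨M, hM⟩ := bounded_of_sq_step (s := fun k => √(U k)) (δ := fun k => ε k * (2 * ρ⁻¹))
      (fun k => Real.sqrt_nonneg _) (fun k => mul_nonneg (hε k) (by positivity))
      (hεsum.mul_right _) (fun k => by
        rw [Real.sq_sqrt (hU0 _), Real.sq_sqrt (hU0 _)]
        have h1 := hstep xs ws hs hfeas k
        have h2 := mul_le_mul_of_nonneg_left (hle (k + 1)) (hε k)
        have h3 := hposT (w (k + 1) - w k)
        have h4 : 0 ≤ (2 - τ) * σ * ‖A.adjoint (w k) - c‖ ^ 2 := by positivity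
        simp only [hp] at h1
        simp only [hU] at h2 ⊢
        linarith)
    exact ⟨ρ⁻¹ * M, fun k => (hle k).trans (by gcongr; exact hM k)⟩
  have hdescent : ∀ xs ws, -(gradient h ws) - A xs ∈ ESubdiff φ ws → A.adjoint ws = c →
      (∃ l, Tendsto (V xs ws) atTop (𝓝 l)) ∧ Summable p := by
    intro xs' ws' hs' hfeas'
    have hR' : ∀ k, ‖w k - ws'‖ ≤ R + ‖ws - ws'‖ := fun k =>
      (norm_sub_le_norm_sub_add_norm_sub _ ws _).trans (by gcongr; exact hR k)
    refine quasi_descent (δ := fun k => ε k * (2 * (R + ‖ws - ws'‖))) (hV0 _ _) hp0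
      (fun k => mul_nonneg (hε k) (mul_nonneg two_pos.le ((norm_nonneg _).trans (hR' 0))))
      (hεsum.mul_right _) (fun k => (hstep xs' ws' hs' hfeas' k).trans ?_)
    have := mul_le_mul_of_nonneg_left (hR' (k + 1)) (hε k)
    linarith
  obtain ⟨⟨l, hl⟩, hpsum⟩ := hdescent xs ws hs hfeas
  -- the residuals vanish
  have hp_lim := hpsum.tendsto_atTop_zero
  have hr1 : Tendsto (fun k => ‖A.adjoint (w (k + 1)) - c‖ ^ 2) atTop (𝓝 0) := by
    have h1 := hp_lim.const_mul ((2 - τ) * σ)⁻¹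
    rw [mul_zero] at h1
    refine squeeze_zero (fun k => by positivity) (fun k => ?_) h1
    rw [← div_eq_inv_mul, le_div_iff₀ hρ]
    have := hposT (w (k + 1) - w k)
    simp only [hp]
    linarith
  have hr : Tendsto (fun k => A.adjoint (w k) - c) atTop (𝓝 0) := by
    rw [← tendsto_add_atTop_iff_nat 1, tendsto_zero_iff_norm_tendsto_zero]
    simpa using hr1.sqrt
  have hΔ : Tendsto (fun k => w (k + 1) - w k) atTop (𝓝 0) := by
    have hAΔ : Tendsto (fun k => A.adjoint (w (k + 1) - w k)) atTop (𝓝 0) := by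
      have h1 := ((tendsto_add_atTop_iff_nat 1).2 hr).sub hr
      simpa using h1
    have h2 : Tendsto (fun k => μ⁻¹ * (p k + σ * ‖A.adjoint (w (k + 1) - w k)‖ ^ 2))
        atTop (𝓝 0) := by
      simpa using (hp_lim.add ((hAΔ.norm.pow 2).const_mul σ)).const_mul μ⁻¹
    have h3 : Tendsto (fun k => ‖w (k + 1) - w k‖ ^ 2) atTop (𝓝 0) := by
      refine squeeze_zero (fun k => by positivity) (fun k => ?_) h2
      rw [← div_eq_inv_mul, le_div_iff₀ hμ]
      have h4 := hcoer (w (k + 1) - w k)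
      have h5 : 0 ≤ (2 - τ) * σ * ‖A.adjoint (w (k + 1)) - c‖ ^ 2 := by positivity
      simp only [hp]
      linarith
    rw [tendsto_zero_iff_norm_tendsto_zero]
    simpa using h3.sqrt
  have hd0 : Tendsto d atTop (𝓝 0) := squeeze_zero_norm hd hεsum.tendsto_atTop_zero
  -- extraction of a cluster point
  obtain ⟨M, hM⟩ := hl.bddAbove_range
  have hxb : ∀ k, ‖x k - xs‖ ≤ √(M * (τ * σ)) := fun k => by
    refine Real.le_sqrt_of_sq_le ?_
    rw [← div_le_iff₀ hτσ]
    have h1 : V xs ws k ≤ M := hM ⟨k, rfl⟩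
    have h2 := hposV (w k - ws)
    simp only [hV] at h1
    linarith
  obtain ⟨⟨xinf, winf⟩, -, θ, hθ, hlim⟩ :=
    ((isCompact_closedBall xs (√(M * (τ * σ)))).prod (isCompact_closedBall ws R)).tendsto_subseq
      (x := fun k => (x k, w k)) fun k =>
        ⟨mem_closedBall_iff_norm.2 (hxb k), mem_closedBall_iff_norm.2 (hR k)⟩
  have hxθ : Tendsto (fun n => x (θ n)) atTop (𝓝 xinf) := (continuous_fst.tendsto _).comp hlim
  have hwθ : Tendsto (fun n => w (θ n)) atTop (𝓝 winf) := (continuous_snd.tendsto _).comp hlim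
  have hθ' := hθ.tendsto_atTop
  have hΔθ := hΔ.comp hθ'
  have hwθ' : Tendsto (fun n => w (θ n + 1)) atTop (𝓝 winf) := by
    simpa using hΔθ.add hwθ
  have hrθ : Tendsto (fun n => A.adjoint (w (θ n + 1)) - c) atTop (𝓝 0) :=
    ((tendsto_add_atTop_iff_nat 1).2 hr).comp hθ'
  have hfeasinf : A.adjoint winf = c := by
    rw [← sub_eq_zero]
    exact tendsto_nhds_unique (((A.adjoint.continuous.tendsto _).comp hwθ').sub_const c) hrθ
  have hsinf : -(gradient h winf) - A xinf ∈ ESubdiff φ winf := by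
    refine mem_ESubdiff_of_tendsto hφlsc hφbot ?_ hwθ' fun n => hg (θ n)
    have h1 := ((hd0.comp hθ').sub ((S.continuous.tendsto _).comp hΔθ)).sub
      ((((hgradc.tendsto _).comp hwθ).add ((Sig.continuous.tendsto _).comp hΔθ)).add
        ((A.continuous.tendsto _).comp (hxθ.add (hrθ.const_smul σ))))
    have h2 : -(gradient h winf) - A xinf = 0 - S 0 - (gradient h winf + Sig 0
        + A (xinf + σ • (0 : X))) := by
      simp only [map_zero, smul_zero, add_zero, sub_zero]; abel
    rw [h2]
    exact h1
  -- the Lyapunov function at the cluster point tends to zero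
  obtain ⟨⟨l', hl'⟩, -⟩ := hdescent xinf winf hsinf hfeasinf
  have hVθ : Tendsto (fun n => V xinf winf (θ n)) atTop (𝓝 0) := by
    have h1 : Tendsto (fun n => w (θ n) - winf) atTop (𝓝 0) := by
      simpa using hwθ.sub_const winf
    have h2 : Tendsto (fun n => x (θ n) - xinf) atTop (𝓝 0) := by
      simpa using hxθ.sub_const xinf
    have h3 := ((((Sig.continuous.tendsto _).comp h1).inner h1).add
      (((S.continuous.tendsto _).comp h1).inner h1)).add ((h2.norm.pow 2).div_const (τ * σ))
    simpa [hV] using h3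
  have hlim_zero : l' = 0 := tendsto_nhds_unique (hl'.comp hθ') hVθ
  rw [hlim_zero] at hl'
  refine ⟨xinf, winf, ⟨hsinf, hfeasinf⟩, ?_, ?_⟩
  · rw [tendsto_iff_norm_sub_tendsto_zero]
    have h1 : Tendsto (fun k => ‖x k - xinf‖ ^ 2) atTop (𝓝 0) := by
      refine squeeze_zero (fun k => by positivity) (fun k => ?_)
        (by simpa using hl'.mul_const (τ * σ))
      rw [← div_le_iff₀ hτσ]
      have := hposV (w k - winf)
      simp only [hV]
      linarith
    simpa using h1.sqrt
  · rw [tendsto_iff_norm_sub_tendsto_zero]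
    have h1 : Tendsto (fun k => ‖w k - winf‖ ^ 2) atTop (𝓝 0) := by
      have h2 : Tendsto (fun k => μ⁻¹ * (V xinf winf k + σ * ‖A.adjoint (w k) - c‖ ^ 2))
          atTop (𝓝 0) := by
        simpa using (hl'.add ((hr.norm.pow 2).const_mul σ)).const_mul μ⁻¹
      refine squeeze_zero (fun k => by positivity) (fun k => ?_) h2
      rw [← div_eq_inv_mul, le_div_iff₀ hμ]
      have h3 := hcoer (w k - winf)
      have h4 := hSigpsd (w k - winf)
      have h5 : 0 ≤ ‖x k - xinf‖ ^ 2 / (τ * σ) := by positivity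
      have h6 : A.adjoint (w k - winf) = A.adjoint (w k) - c := by rw [map_sub, hfeasinf]
      rw [h6] at h3
      simp only [hV]
      linarith
    simpa using h1.sqrt
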